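/- Let G be a finite group of nilpotency class at most two, and let N be the subgroup of the permutation group of G^ω generated by the set {x^i·σ_g·x^{−i} : i ∈ ℤ, g ∈ G}. Then every non-identity element γ of N can be written in the form γ = x^{i_1}·σ_{f_1}·x^{−i_1} · x^{i_2}·σ_{f_2}·x^{−i_2} ⋯ x^{i_j}·σ_{f_j}·x^{−i_j} for some positive integer j, integers i_1 < i_2 < … < i_j, and elements f_1, …, f_j ∈ G with f_l ≠ 1 for all l; moreover this expression is unique. -/

import Mathlib

/-- The Cayley machine transformation of a group `G` at state `g`, acting on right-infinite
words `w : ℕ → G`: `(cayley g w) n = g * w 0 * w 1 * ⋯ * w n`. -/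
def cayley {G : Type*} [Group G] (g : G) : Equiv.Perm (ℕ → G) where
  toFun w n := g * ((List.range (n + 1)).map w).prod
  invFun v n :=
    match n with
    | 0 => g⁻¹ * v 0
    | m + 1 => (v m)⁻¹ * v (m + 1)
  left_inv w := by
    funext n
    match n with
    | 0 => simp [List.range_succ]
    | m + 1 => simp [List.range_succ, mul_assoc]
  right_inv v := by
    funext n
    induction n with
    | zero => simp [List.range_succ]
    | succ m ih =>
      beta_reduce at ih ⊢
      rw [List.range_succ, List.map_append, List.prod_append, ← mul_assoc, ih]
      simp [mul_assoc]

/-- The permutation `x = C₁⁻¹`, the inverse of the Cayley machine transformation at the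
identity state.  It satisfies `(x w) 0 = w 0` and `(x w) n = (w (n-1))⁻¹ * w n` for `n ≥ 1`. -/
def xPerm (G : Type*) [Group G] : Equiv.Perm (ℕ → G) := (cayley (1 : G))⁻¹

/-- The permutation `σ_g = x * C_g`, given by `(σ_g w) 0 = g * w 0` and `(σ_g w) n = w n`
for `n ≥ 1`.  The map `g ↦ σ_g` identifies `G` with a subgroup of the automata group. -/
def sigma' {G : Type*} [Group G] (g : G) : Equiv.Perm (ℕ → G) := xPerm G * cayley g

/-! ### Ordered products in a group -/

section OrderedProducts

variable {G Γ : Type*} [Group G] [Group Γ] (s : ℤ → G →* Γ)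

/-- The product in `Γ` of the images `s i g` over a list of pairs `(i, g)`. -/
def listProd (l : List (ℤ × G)) : Γ := (l.map fun a => s a.1 a.2).prod

theorem listProd_nil : listProd s [] = 1 := rfl

theorem listProd_cons (a : ℤ × G) (l : List (ℤ × G)) :
    listProd s (a :: l) = s a.1 a.2 * listProd s l := by
  simp [listProd]

theorem listProd_concat (l : List (ℤ × G)) (a : ℤ × G) :
    listProd s (l ++ [a]) = listProd s l * s a.1 a.2 := by
  simp [listProd]

/-- Lists of pairs whose first components are strictly increasing. -/
def IncreasingKeys (l : List (ℤ × G)) : Prop := l.Pairwise fun a b => a.1 < b.1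

theorem exists_listProd_eq_mul_of_commutator (D : Subgroup Γ)
    (hD : ∀ d ∈ D, ∀ i g, s i g * d = d * s i g) (i : ℤ) (g : G)
    (hcomm : ∀ j h, j < i → ∃ d ∈ D, s i g * s j h = d * (s j h * s i g))
    (l : List (ℤ × G)) (hl : IncreasingKeys l) :
    ∃ l', IncreasingKeys l' ∧ (∀ a ∈ l', a.1 = i ∨ ∃ b ∈ l, a.1 = b.1) ∧
      ∃ d ∈ D, s i g * listProd s l = d * listProd s l' := by
  induction l with
  | nil =>
    exact ⟨[(i, g)], List.pairwise_singleton _ _, by simp, 1, D.one_mem, by simp [listProd]⟩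
  | cons b t ih =>
    obtain ⟨j, h⟩ := b
    obtain ⟨hb, ht⟩ := List.pairwise_cons.1 hl
    rcases lt_trichotomy i j with hij | rfl | hij
    · refine ⟨(i, g) :: (j, h) :: t, List.pairwise_cons.2 ⟨?_, hl⟩, ?_, 1, D.one_mem, ?_⟩
      · rintro a (_ | ⟨_, ha⟩)
        · exact hij
        · exact hij.trans (hb a ha)
      · intro a ha
        rcases List.mem_cons.1 ha with rfl | ha
        · exact Or.inl rfl
        · exact Or.inr ⟨a, ha, rfl⟩
      · rw [one_mul, listProd_cons s (i, g)]
    · refine ⟨(i, g * h) :: t, List.pairwise_cons.2 ⟨hb, ht⟩, ?_, 1, D.one_mem, ?_⟩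
      · intro a ha
        rcases List.mem_cons.1 ha with rfl | ha
        · exact Or.inl rfl
        · exact Or.inr ⟨a, List.mem_cons_of_mem _ ha, rfl⟩
      · simp [listProd_cons, mul_assoc]
    · obtain ⟨l', hl', hkeys, d, hd, hprod⟩ := ih ht
      obtain ⟨e, he, hcomm⟩ := hcomm j h hij
      refine ⟨(j, h) :: l', List.pairwise_cons.2 ⟨?_, hl'⟩, ?_, e * d, D.mul_mem he hd, ?_⟩
      · intro a ha
        rcases hkeys a ha with h | ⟨b, hbt, h⟩
        · exact h ▸ hij
        · exact h ▸ hb b hbt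
      · intro a ha
        rcases List.mem_cons.1 ha with rfl | ha
        · exact Or.inr ⟨(j, h), List.mem_cons_self, rfl⟩
        · exact (hkeys a ha).imp id fun ⟨b, hbt, h⟩ => ⟨b, List.mem_cons_of_mem _ hbt, h⟩
      · rw [listProd_cons, listProd_cons, ← mul_assoc, hcomm, mul_assoc, mul_assoc, hprod,
          ← mul_assoc (s j h), hD d hd]
        simp only [mul_assoc]

/-- If the commutators of the subgroups `s i G` lie in the subgroup generated by the `s i z` with
`z` central, and the latter commute with all `s j h`, then every element of the group generated
by the `s i g` is an ordered product. -/
theorem exists_listProd_eq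
    (hcentral : ∀ i, ∀ z ∈ Subgroup.center G, ∀ j h, s i z * s j h = s j h * s i z)
    (hcomm : ∀ i g j h, j < i → ∃ d ∈ Subgroup.closure
      {p | ∃ (k : ℤ) (z : G), z ∈ Subgroup.center G ∧ p = s k z},
      s i g * s j h = d * (s j h * s i g))
    {γ : Γ} (hγ : γ ∈ Subgroup.closure {p | ∃ i g, p = s i g}) :
    ∃ l, IncreasingKeys l ∧ γ = listProd s l := by
  set D := Subgroup.closure {p | ∃ (k : ℤ) (z : G), z ∈ Subgroup.center G ∧ p = s k z} with hDdef
  have hD : ∀ d ∈ D, ∀ i g, s i g * d = d * s i g := by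
    intro d hd i g
    have hle : D ≤ Subgroup.centralizer {s i g} := by
      rw [hDdef, Subgroup.closure_le]
      rintro _ ⟨k, z, hz, rfl⟩
      exact Subgroup.mem_centralizer_singleton_iff.2 (hcentral k z hz i g)
    exact (Subgroup.mem_centralizer_singleton_iff.1 (hle hd)).symm
  have hcentral_mul : ∀ k, ∀ z ∈ Subgroup.center G, ∀ l : List (ℤ × G), IncreasingKeys l →
      ∃ l', IncreasingKeys l' ∧ s k z * listProd s l = listProd s l' := by
    intro k z hz l hl
    obtain ⟨l', hl', -, d, hd, h⟩ := exists_listProd_eq_mul_of_commutator s ⊥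
      (by simp) k z (fun j h _ => ⟨1, Subgroup.one_mem _, by simp [hcentral k z hz j h]⟩) l hl
    rw [Subgroup.mem_bot] at hd
    exact ⟨l', hl', by simpa [hd] using h⟩
  have hD_mul : ∀ d ∈ D, ∀ l : List (ℤ × G), IncreasingKeys l →
      ∃ l', IncreasingKeys l' ∧ d * listProd s l = listProd s l' := by
    intro d hd
    induction hd using Subgroup.closure_induction_left with
    | one => exact fun l hl => ⟨l, hl, one_mul _⟩
    | mul_left p hp y _ ih =>
      obtain ⟨k, z, hz, rfl⟩ := hp
      intro l hl
      obtain ⟨l', hl', h⟩ := ih l hl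
      rw [mul_assoc, h]
      exact hcentral_mul k z hz l' hl'
    | inv_mul_cancel p hp y _ ih =>
      obtain ⟨k, z, hz, rfl⟩ := hp
      intro l hl
      obtain ⟨l', hl', h⟩ := ih l hl
      rw [mul_assoc, h, ← map_inv]
      exact hcentral_mul k z⁻¹ (Subgroup.inv_mem _ hz) l' hl'
  have hmul : ∀ i g, ∀ l : List (ℤ × G), IncreasingKeys l →
      ∃ l', IncreasingKeys l' ∧ s i g * listProd s l = listProd s l' := by
    intro i g l hl
    obtain ⟨l₁, hl₁, -, d, hd, h₁⟩ :=
      exists_listProd_eq_mul_of_commutator s D hD i g (fun j h => hcomm i g j h) l hl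
    rw [h₁]
    exact hD_mul d hd l₁ hl₁
  induction hγ using Subgroup.closure_induction_left with
  | one => exact ⟨[], List.Pairwise.nil, rfl⟩
  | mul_left p hp y _ ih =>
    obtain ⟨i, g, rfl⟩ := hp
    obtain ⟨l, hl, rfl⟩ := ih
    obtain ⟨l', hl', h⟩ := hmul i g l hl
    exact ⟨l', hl', h⟩
  | inv_mul_cancel p hp y _ ih =>
    obtain ⟨i, g, rfl⟩ := hp
    obtain ⟨l, hl, rfl⟩ := ih
    rw [← map_inv]
    obtain ⟨l', hl', h⟩ := hmul i g⁻¹ l hl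
    exact ⟨l', hl', h⟩

theorem exists_increasingKeys_ne_one_listProd_eq {l : List (ℤ × G)} (hl : IncreasingKeys l) :
    ∃ l', IncreasingKeys l' ∧ (∀ a ∈ l', a.2 ≠ 1) ∧ listProd s l = listProd s l' := by
  classical
  refine ⟨l.filter (fun b => b.2 ≠ 1), hl.filter _, by simp, ?_⟩
  clear hl
  induction l with
  | nil => rfl
  | cons b l ih => by_cases hb : b.2 = 1 <;> simp [listProd_cons, hb, ih]

/-- Ordered products with nontrivial factors are determined by their value as soon as there is a
family of subgroups `H m` containing the factors of index less than `m` and no nontrivial factor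
of index `m`. -/
theorem eq_of_listProd_eq (H : ℤ → Subgroup Γ) (hlt : ∀ i m g, i < m → s i g ∈ H m)
    (hself : ∀ m g, s m g ∈ H m → g = 1) (l l' : List (ℤ × G))
    (hl : IncreasingKeys l) (hl' : IncreasingKeys l')
    (hne : ∀ a ∈ l, a.2 ≠ 1) (hne' : ∀ a ∈ l', a.2 ≠ 1)
    (h : listProd s l = listProd s l') : l = l' := by
  have hmem : ∀ (l : List (ℤ × G)) (m : ℤ), (∀ a ∈ l, a.1 < m) → listProd s l ∈ H m := by
    intro l m hl
    refine Subgroup.list_prod_mem _ fun p hp => ?_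
    obtain ⟨a, ha, rfl⟩ := List.mem_map.1 hp
    exact hlt _ _ _ (hl a ha)
  have hlast : ∀ (l : List (ℤ × G)) (a : ℤ × G), IncreasingKeys (l ++ [a]) →
      IncreasingKeys l ∧ ∀ b ∈ l, b.1 < a.1 := by
    intro l a hla
    have := List.pairwise_append.1 hla
    exact ⟨this.1, fun b hb => this.2.2 b hb a (by simp)⟩
  have hnot : ∀ (l l' : List (ℤ × G)) (a : ℤ × G), (∀ b ∈ l, b.1 < a.1) →
      (∀ b ∈ l', b.1 < a.1) → a.2 ≠ 1 → listProd s l ≠ listProd s (l' ++ [a]) := by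
    intro l l' a hl hl' ha heq
    rw [listProd_concat, ← inv_mul_eq_iff_eq_mul] at heq
    exact ha (hself a.1 a.2 (heq ▸ mul_mem (inv_mem (hmem l' _ hl')) (hmem l _ hl)))
  induction l using List.reverseRecOn generalizing l' with
  | nil =>
    rcases List.eq_nil_or_concat' l' with rfl | ⟨t', a', rfl⟩
    · rfl
    · exact absurd h (hnot _ _ _ (by simp) (hlast _ _ hl').2 (hne' a' (by simp)))
  | append_singleton t a ih =>
    rcases List.eq_nil_or_concat' l' with rfl | ⟨t', a', rfl⟩
    · exact absurd h.symm (hnot _ _ _ (by simp) (hlast _ _ hl).2 (hne a (by simp)))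
    · obtain ⟨ht, hta⟩ := hlast _ _ hl
      obtain ⟨ht', hta'⟩ := hlast _ _ hl'
      have hkey : ∀ (t : List (ℤ × G)) (a b : ℤ × G), (∀ c ∈ t, c.1 < a.1) → a.1 < b.1 →
          ∀ c ∈ t ++ [a], c.1 < b.1 := by
        intro t a b hta hab c hc
        rcases List.mem_append.1 hc with hc | hc
        · exact (hta c hc).trans hab
        · rw [List.mem_singleton.1 hc]
          exact hab
      obtain ⟨i, g⟩ := a
      obtain ⟨i', g'⟩ := a'
      rcases lt_trichotomy i i' with hii | rfl | hii
      · exact absurd h (hnot _ _ _ (hkey _ _ _ hta hii) hta' (hne' (i', g') (by simp)))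
      · have hg : g = g' := by
          rw [listProd_concat, listProd_concat] at h
          have : (listProd s t')⁻¹ * listProd s t = s i (g' * g⁻¹) := by
            rw [map_mul, map_inv, eq_mul_inv_iff_mul_eq, mul_assoc, inv_mul_eq_iff_eq_mul]
            exact h
          have := hself i _ (this ▸ mul_mem (inv_mem (hmem t' _ hta')) (hmem t _ hta))
          exact (mul_inv_eq_one.1 this).symm
        subst hg
        rw [listProd_concat, listProd_concat, mul_left_inj] at h
        rw [ih t' ht ht' (fun a ha => hne a (by simp [ha])) (fun a ha => hne' a (by simp [ha])) h]
      · exact absurd h.symm (hnot _ _ _ (hkey _ _ _ hta' hii) hta (hne (i, g) (by simp)))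

end OrderedProducts

/-! ### The permutation `x` and the translations of `G^ω` -/

section Words

variable {G : Type*} [Group G]

/-- The endomorphism of `G^ω` that prepends the letter `1`. -/
def prependOne (G : Type*) [Group G] : (ℕ → G) →* (ℕ → G) where
  toFun w n := match n with
    | 0 => 1
    | m + 1 => w m
  map_one' := by funext n; cases n <;> rfl
  map_mul' u v := by funext n; cases n <;> simp

theorem xPerm_apply (w : ℕ → G) : xPerm G w = (prependOne G w)⁻¹ * w := by
  funext n
  cases n with
  | zero => simp [xPerm, cayley, prependOne]
  | succ n => simp [xPerm, cayley, prependOne]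

theorem xPerm_apply_zero (w : ℕ → G) : xPerm G w 0 = w 0 := by
  simp [xPerm_apply, prependOne]

theorem xPerm_apply_succ (w : ℕ → G) (n : ℕ) : xPerm G w (n + 1) = (w n)⁻¹ * w (n + 1) := by
  simp [xPerm_apply, prependOne]

theorem xPerm_inv_apply_xPerm (w : ℕ → G) : (xPerm G)⁻¹ (xPerm G w) = w :=
  (xPerm G).symm_apply_apply w

theorem cayley_eq (g : G) (w : ℕ → G) :
    cayley g w = cayley 1 (Pi.mulSingle 0 g * w) := by
  funext n
  change g * _ = 1 * _
  rw [List.range_succ_eq_map]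
  simp [mul_assoc, Function.comp_def]

/-- The left regular representation of a group by permutations. -/
abbrev leftMul (W : Type*) [Group W] : W →* Equiv.Perm W := MulAction.toPermHom W W

theorem sigma'_eq_leftMul (g : G) : sigma' g = leftMul (ℕ → G) (Pi.mulSingle 0 g) := by
  ext1 w
  rw [sigma', Equiv.Perm.mul_apply, cayley_eq]
  exact (cayley (1 : G)).symm_apply_apply _

/-- The conjugates `xⁱ σ_g x⁻ⁱ`, as homomorphisms in the variable `g`. -/
def conjSigma (G : Type*) [Group G] (i : ℤ) : G →* Equiv.Perm (ℕ → G) :=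
  (MulAut.conj (xPerm G ^ i)).toMonoidHom.comp
    ((leftMul (ℕ → G)).comp (MonoidHom.mulSingle (fun _ : ℕ => G) 0))

theorem conjSigma_apply (i : ℤ) (g : G) :
    conjSigma G i g = xPerm G ^ i * sigma' g * (xPerm G ^ i)⁻¹ := by
  rw [sigma'_eq_leftMul]
  rfl

theorem conj_conjSigma (r i : ℤ) (g : G) :
    xPerm G ^ r * conjSigma G i g * (xPerm G ^ r)⁻¹ = conjSigma G (r + i) g := by
  simp only [conjSigma_apply, zpow_add]
  group

theorem mem_center_pi_iff {w : ℕ → G} :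
    w ∈ Subgroup.center (ℕ → G) ↔ ∀ n, w n ∈ Subgroup.center G := by
  simp only [Subgroup.mem_center_iff]
  constructor
  · intro h n g
    exact congrFun (h fun _ => g) n
  · intro h v
    funext n
    exact h n (v n)

theorem prependOne_mem_center {c : ℕ → G} (hc : c ∈ Subgroup.center (ℕ → G)) :
    prependOne G c ∈ Subgroup.center (ℕ → G) := by
  rw [mem_center_pi_iff] at hc ⊢
  intro n
  cases n with
  | zero => exact Subgroup.one_mem _
  | succ n => exact hc n

theorem xPerm_mem_center {c : ℕ → G} (hc : c ∈ Subgroup.center (ℕ → G)) :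
    xPerm G c ∈ Subgroup.center (ℕ → G) := by
  rw [xPerm_apply]
  exact mul_mem (inv_mem (prependOne_mem_center hc)) hc

theorem mem_center_of_xPerm_mem_center {c : ℕ → G} (hc : xPerm G c ∈ Subgroup.center (ℕ → G)) :
    c ∈ Subgroup.center (ℕ → G) := by
  rw [mem_center_pi_iff] at hc ⊢
  intro n
  induction n with
  | zero => simpa [xPerm_apply_zero] using hc 0
  | succ n ih =>
    have := mul_mem ih (hc (n + 1))
    rwa [xPerm_apply_succ, mul_inv_cancel_left] at this

theorem xPerm_mul_of_mem_center {c : ℕ → G} (hc : c ∈ Subgroup.center (ℕ → G)) (w : ℕ → G) :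
    xPerm G (c * w) = xPerm G c * xPerm G w := by
  have h := Subgroup.mem_center_iff.1 (inv_mem (prependOne_mem_center hc)) (prependOne G w)⁻¹
  have h' := Subgroup.mem_center_iff.1 hc (prependOne G w)⁻¹
  simp only [xPerm_apply, map_mul, mul_inv_rev]
  rw [h, mul_assoc, ← mul_assoc _ c, h']
  simp only [mul_assoc]

/-- The group of translations of `G^ω` by central words. -/
def centralTranslations (G : Type*) [Group G] : Subgroup (Equiv.Perm (ℕ → G)) :=
  (Subgroup.center (ℕ → G)).map (leftMul (ℕ → G))

theorem xPerm_mul_leftMul {c : ℕ → G} (hc : c ∈ Subgroup.center (ℕ → G)) :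
    xPerm G * leftMul (ℕ → G) c * (xPerm G)⁻¹ = leftMul (ℕ → G) (xPerm G c) := by
  rw [mul_inv_eq_iff_eq_mul]
  ext1 w
  exact xPerm_mul_of_mem_center hc w

theorem xPerm_mem_normalizer_centralTranslations :
    xPerm G ∈ Subgroup.normalizer (centralTranslations G : Set (Equiv.Perm (ℕ → G))) := by
  rw [Subgroup.mem_normalizer_iff]
  intro p
  constructor
  · rintro ⟨c, hc, rfl⟩
    exact ⟨xPerm G c, xPerm_mem_center hc, (xPerm_mul_leftMul hc).symm⟩
  · rintro ⟨c, hc, h⟩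
    obtain ⟨d, rfl⟩ := (xPerm G).surjective c
    have hd := mem_center_of_xPerm_mem_center hc
    refine ⟨d, hd, ?_⟩
    rw [← xPerm_mul_leftMul hd] at h
    exact mul_left_cancel (mul_right_cancel h)

theorem mem_centralTranslations_conj (i : ℤ) {p : Equiv.Perm (ℕ → G)} :
    xPerm G ^ i * p * (xPerm G ^ i)⁻¹ ∈ centralTranslations G ↔ p ∈ centralTranslations G :=
  (Subgroup.mem_normalizer_iff.1 (zpow_mem xPerm_mem_normalizer_centralTranslations i) p).symm

theorem commute_leftMul_of_mem_centralTranslations {t : Equiv.Perm (ℕ → G)}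
    (ht : t ∈ centralTranslations G) (u : ℕ → G) : Commute t (leftMul (ℕ → G) u) := by
  obtain ⟨c, hc, rfl⟩ := ht
  rw [Commute, SemiconjBy, ← map_mul, ← map_mul, Subgroup.mem_center_iff.1 hc]

theorem commute_conjSigma_of_mem_centralTranslations {t : Equiv.Perm (ℕ → G)}
    (ht : t ∈ centralTranslations G) (i : ℤ) (g : G) : Commute t (conjSigma G i g) := by
  have h : (xPerm G ^ i)⁻¹ * t * xPerm G ^ i ∈ centralTranslations G := by
    rw [← mem_centralTranslations_conj i]
    convert ht using 1
    group
  have hcomm := (commute_leftMul_of_mem_centralTranslations h (Pi.mulSingle 0 g)).map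
    (MulAut.conj (xPerm G ^ i))
  have hconj : MulAut.conj (xPerm G ^ i) ((xPerm G ^ i)⁻¹ * t * xPerm G ^ i) = t := by
    rw [MulAut.conj_apply]
    group
  rw [hconj] at hcomm
  exact hcomm

theorem mulSingle_mem_center {z : G} (hz : z ∈ Subgroup.center G) (n : ℕ) :
    (Pi.mulSingle n z : ℕ → G) ∈ Subgroup.center (ℕ → G) := by
  rw [mem_center_pi_iff]
  intro k
  rcases eq_or_ne k n with rfl | hk
  · simpa using hz
  · simp [Pi.mulSingle_eq_of_ne hk]

theorem conjSigma_mem_centralTranslations (i : ℤ) {z : G} (hz : z ∈ Subgroup.center G) :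
    conjSigma G i z ∈ centralTranslations G := by
  rw [conjSigma_apply, mem_centralTranslations_conj, sigma'_eq_leftMul]
  exact ⟨_, mulSingle_mem_center hz 0, rfl⟩

/-! ### Central translations by words of finite support -/

/-- The subgroup generated by the `xⁱ σ_z x⁻ⁱ` with `z` central. -/
def centralConjSigma (G : Type*) [Group G] : Subgroup (Equiv.Perm (ℕ → G)) :=
  Subgroup.closure {p | ∃ (k : ℤ) (z : G), z ∈ Subgroup.center G ∧ p = conjSigma G k z}

theorem conj_mem_centralConjSigma (r : ℤ) {p : Equiv.Perm (ℕ → G)}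
    (hp : p ∈ centralConjSigma G) :
    xPerm G ^ r * p * (xPerm G ^ r)⁻¹ ∈ centralConjSigma G := by
  have hle : centralConjSigma G ≤
      (centralConjSigma G).comap (MulAut.conj (xPerm G ^ r)).toMonoidHom := by
    refine (Subgroup.closure_le _).2 ?_
    rintro _ ⟨k, z, hz, rfl⟩
    exact Subgroup.subset_closure ⟨r + k, z, hz, conj_conjSigma r k z⟩
  exact hle hp

theorem xPerm_mulSingle (n : ℕ) (z : G) :
    xPerm G (Pi.mulSingle n z) = Pi.mulSingle n z * (Pi.mulSingle (n + 1) z)⁻¹ := by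
  funext k
  cases k with
  | zero => simp [xPerm_apply_zero, Pi.mulSingle_apply]
  | succ k =>
    simp only [xPerm_apply_succ, Pi.mul_apply, Pi.inv_apply, Pi.mulSingle_apply]
    split_ifs <;> first | omega | simp

theorem leftMul_mulSingle_mem_centralConjSigma (n : ℕ) {z : G} (hz : z ∈ Subgroup.center G) :
    leftMul (ℕ → G) (Pi.mulSingle n z) ∈ centralConjSigma G := by
  induction n with
  | zero =>
    refine Subgroup.subset_closure ⟨0, z, hz, ?_⟩
    simp [conjSigma_apply, sigma'_eq_leftMul]
  | succ n ih =>
    have h := conj_mem_centralConjSigma 1 ih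
    rw [zpow_one, xPerm_mul_leftMul (mulSingle_mem_center hz n), xPerm_mulSingle, map_mul,
      map_inv] at h
    exact inv_mem_iff.1 ((Subgroup.mul_mem_cancel_left _ ih).1 h)

theorem leftMul_mem_centralConjSigma (n : ℕ) {c : ℕ → G} (hc : c ∈ Subgroup.center (ℕ → G))
    (hn : ∀ k, n ≤ k → c k = 1) : leftMul (ℕ → G) c ∈ centralConjSigma G := by
  induction n generalizing c with
  | zero =>
    have : c = 1 := funext fun k => hn k k.zero_le
    rw [this, map_one]
    exact one_mem _
  | succ n ih =>
    have hcn := leftMul_mulSingle_mem_centralConjSigma n (mem_center_pi_iff.1 hc n)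
    refine (Subgroup.mul_mem_cancel_right _ (inv_mem hcn)).1 ?_
    rw [← map_inv, ← map_mul]
    refine ih (mul_mem hc (inv_mem (mulSingle_mem_center (mem_center_pi_iff.1 hc n) n))) ?_
    intro k hk
    rcases hk.eq_or_lt with rfl | hk
    · simp
    · simp [hn k hk, Pi.mulSingle_eq_of_ne hk.ne']

/-! ### Letters left unchanged -/

/-- The permutations of `G^ω` that change no letter in position `n` or later. -/
def fixTail (G : Type*) [Group G] (n : ℕ) : Subgroup (Equiv.Perm (ℕ → G)) where
  carrier := {p | ∀ w k, n ≤ k → p w k = w k}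
  one_mem' _ _ _ := rfl
  mul_mem' hp hq w k hk := (hp _ k hk).trans (hq w k hk)
  inv_mem' {p} hp w k hk := by
    simpa using (hp (p⁻¹ w) k hk).symm

theorem fixTail_mono {m n : ℕ} (h : m ≤ n) : fixTail G m ≤ fixTail G n :=
  fun _ hp w k hk => hp w k (h.trans hk)

theorem conj_mem_fixTail_succ {n : ℕ} {p : Equiv.Perm (ℕ → G)} (hp : p ∈ fixTail G n) :
    xPerm G * p * (xPerm G)⁻¹ ∈ fixTail G (n + 1) := by
  intro w k hk
  obtain ⟨v, rfl⟩ := (xPerm G).surjective w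
  obtain ⟨k, rfl⟩ := Nat.exists_eq_add_of_le' (Nat.one_le_of_lt hk)
  simp only [Equiv.Perm.mul_apply, xPerm_inv_apply_xPerm, xPerm_apply_succ]
  rw [hp v k (by omega), hp v (k + 1) (by omega)]

theorem mem_fixTail_of_conj_mem {n : ℕ} {p : Equiv.Perm (ℕ → G)} (hp : p ∈ fixTail G (n + 1))
    (hx : xPerm G * p * (xPerm G)⁻¹ ∈ fixTail G (n + 1)) : p ∈ fixTail G n := by
  intro w k hk
  have h := hx (xPerm G w) (k + 1) (by omega)
  simp only [Equiv.Perm.mul_apply, xPerm_inv_apply_xPerm, xPerm_apply_succ] at h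
  rw [hp w (k + 1) (by omega)] at h
  simpa using h

theorem conjSigma_succ (n : ℕ) (g : G) :
    conjSigma G ((n + 1 : ℕ) : ℤ) g = xPerm G * conjSigma G n g * (xPerm G)⁻¹ := by
  have := conj_conjSigma 1 n g
  rw [zpow_one] at this
  rw [this]
  congr 2
  push_cast
  ring

theorem conjSigma_mem_fixTail (n : ℕ) (g : G) : conjSigma G n g ∈ fixTail G (n + 1) := by
  induction n with
  | zero =>
    intro w k hk
    have hk : k ≠ 0 := by omega
    simp [conjSigma_apply, sigma'_eq_leftMul, Pi.mulSingle_eq_of_ne hk]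
  | succ n ih =>
    rw [conjSigma_succ]
    exact conj_mem_fixTail_succ ih

theorem eq_one_of_conjSigma_mem_fixTail {n : ℕ} {g : G} (h : conjSigma G n g ∈ fixTail G n) :
    g = 1 := by
  induction n with
  | zero =>
    have := h 1 0 le_rfl
    simpa [conjSigma_apply, sigma'_eq_leftMul] using this
  | succ n ih =>
    rw [conjSigma_succ] at h
    exact ih (mem_fixTail_of_conj_mem (conjSigma_mem_fixTail n g) h)

/-- The permutations whose conjugates by `xʳ`, for all large `r`, change no letter in position
`m + r` or later. -/
def eventuallyFixTail (G : Type*) [Group G] (m : ℤ) : Subgroup (Equiv.Perm (ℕ → G)) where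
  carrier := {p | ∀ᶠ r : ℤ in Filter.atTop,
    xPerm G ^ r * p * (xPerm G ^ r)⁻¹ ∈ fixTail G (m + r).toNat}
  one_mem' := by simp [one_mem]
  mul_mem' := by
    intro p q hp hq
    filter_upwards [hp, hq] with r hp hq
    convert mul_mem hp hq using 1
    group
  inv_mem' := by
    intro p hp
    filter_upwards [hp] with r hp
    convert inv_mem hp using 1
    group

theorem conjSigma_mem_eventuallyFixTail {i m : ℤ} (h : i < m) (g : G) :
    conjSigma G i g ∈ eventuallyFixTail G m := by
  filter_upwards [Filter.eventually_ge_atTop (-i)] with r hr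
  rw [conj_conjSigma]
  obtain ⟨n, hn⟩ := Int.eq_ofNat_of_zero_le (show 0 ≤ r + i by omega)
  rw [hn]
  exact fixTail_mono (by omega) (conjSigma_mem_fixTail n g)

theorem eq_one_of_conjSigma_mem_eventuallyFixTail {m : ℤ} {g : G}
    (h : conjSigma G m g ∈ eventuallyFixTail G m) : g = 1 := by
  obtain ⟨r, h, hr⟩ := (Filter.Eventually.and h (Filter.eventually_ge_atTop (-m))).exists
  rw [conj_conjSigma] at h
  obtain ⟨n, hn⟩ := Int.eq_ofNat_of_zero_le (show 0 ≤ r + m by omega)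
  rw [hn, show (m + r).toNat = n by omega] at h
  exact eq_one_of_conjSigma_mem_fixTail h

/-! ### Commutators in class two -/

theorem commutator_mem_center_pi (hG : ∀ g h : G, g⁻¹ * h⁻¹ * g * h ∈ Subgroup.center G)
    (u v : ℕ → G) : u⁻¹ * v * u * v⁻¹ ∈ Subgroup.center (ℕ → G) := by
  rw [mem_center_pi_iff]
  intro n
  simpa using hG (u n) (v n)⁻¹

theorem xPerm_mul (u v : ℕ → G) :
    xPerm G (u * v) =
      ((prependOne G v)⁻¹ * xPerm G u * prependOne G v * (xPerm G u)⁻¹) *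
        (xPerm G u * xPerm G v) := by
  simp only [xPerm_apply, map_mul]
  group

/-- The commutators of `p` with all left translations are central translations. -/
def CommutatorsCentral (p : Equiv.Perm (ℕ → G)) : Prop :=
  ∀ u, ∃ c ∈ Subgroup.center (ℕ → G), ∀ v, p (u * v) = c * (u * p v)

theorem CommutatorsCentral.conj (hG : ∀ g h : G, g⁻¹ * h⁻¹ * g * h ∈ Subgroup.center G)
    {p : Equiv.Perm (ℕ → G)} (hp : ∀ t ∈ centralTranslations G, Commute t p)
    (h : CommutatorsCentral p) : CommutatorsCentral (xPerm G * p * (xPerm G)⁻¹) := by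
  intro u
  obtain ⟨u, rfl⟩ := (xPerm G).surjective u
  obtain ⟨c, hc, hcu⟩ := h u
  -- the bilinear defect of multiplicativity of `xPerm`
  let B : (ℕ → G) → (ℕ → G) := fun v =>
    (prependOne G v)⁻¹ * xPerm G u * prependOne G v * (xPerm G u)⁻¹
  have hB : ∀ v, B v ∈ Subgroup.center (ℕ → G) := fun v => commutator_mem_center_pi hG _ _
  have hxB : ∀ v, xPerm G (u * v) = B v * (xPerm G u * xPerm G v) := xPerm_mul u
  have hBmul : ∀ v w, B (v * w) = B v * B w := by
    intro v w
    have : B (v * w) = (prependOne G w)⁻¹ * B v * (xPerm G u * prependOne G w * (xPerm G u)⁻¹) := by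
      simp only [B, map_mul]
      group
    rw [this, Subgroup.mem_center_iff.1 (hB v)]
    simp only [B, mul_assoc]
  have hBcenter : ∀ e ∈ Subgroup.center (ℕ → G), B e = 1 := by
    intro e he
    have := Subgroup.mem_center_iff.1 (prependOne_mem_center he) (xPerm G u)
    simp only [B, mul_assoc]
    rw [← mul_assoc (xPerm G u), this]
    group
  have hBp : ∀ v, B (p v) = B v * B (p 1) := by
    intro v
    obtain ⟨e, he, hev⟩ := h v
    have := hev 1
    rw [mul_one] at this
    rw [this, hBmul, hBmul, hBcenter e he, one_mul]
  refine ⟨xPerm G c * B (p 1), mul_mem (xPerm_mem_center hc) (hB _), fun v => ?_⟩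
  obtain ⟨v, rfl⟩ := (xPerm G).surjective v
  obtain ⟨d, hd⟩ := (xPerm G).surjective (B v)⁻¹
  have hdc : d ∈ Subgroup.center (ℕ → G) :=
    mem_center_of_xPerm_mem_center (hd ▸ inv_mem (hB v))
  have h₁ : xPerm G u * xPerm G v = xPerm G (d * (u * v)) := by
    rw [xPerm_mul_of_mem_center hdc, hd, hxB, inv_mul_cancel_left]
  have h₂ : p (d * (u * v)) = d * p (u * v) :=
    (Equiv.Perm.congr_fun (hp _ ⟨d, hdc, rfl⟩).eq (u * v)).symm
  have h₃ := Subgroup.mem_center_iff.1 (xPerm_mem_center hc) (B v)⁻¹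
  rw [h₁]
  simp only [Equiv.Perm.mul_apply, xPerm_inv_apply_xPerm]
  rw [h₂, hcu, xPerm_mul_of_mem_center hdc, xPerm_mul_of_mem_center hc, hxB, hBp, hd,
    ← mul_assoc, h₃]
  simp only [mul_assoc, inv_mul_cancel_left]

theorem commutatorsCentral_conjSigma (hG : ∀ g h : G, g⁻¹ * h⁻¹ * g * h ∈ Subgroup.center G)
    (n : ℕ) (g : G) : CommutatorsCentral (conjSigma G n g) := by
  induction n with
  | zero =>
    intro u
    refine ⟨_, commutator_mem_center_pi hG (Pi.mulSingle 0 g)⁻¹ u, fun v => ?_⟩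
    simp only [conjSigma_apply, sigma'_eq_leftMul, Nat.cast_zero, zpow_zero, one_mul, inv_one,
      mul_one, MulAction.toPermHom_apply, MulAction.toPerm_apply, smul_eq_mul]
    group
  | succ n ih =>
    rw [conjSigma_succ]
    exact ih.conj hG fun t ht => commute_conjSigma_of_mem_centralTranslations ht n g

theorem exists_conjSigma_mul_conjSigma_eq
    (hG : ∀ g h : G, g⁻¹ * h⁻¹ * g * h ∈ Subgroup.center G) (i : ℤ) (g : G) (j : ℤ) (h : G)
    (hij : j < i) : ∃ d ∈ centralConjSigma G,
      conjSigma G i g * conjSigma G j h = d * (conjSigma G j h * conjSigma G i g) := by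
  obtain ⟨n, rfl⟩ : ∃ n : ℕ, i = j + n := ⟨(i - j).toNat, by omega⟩
  obtain ⟨c, hc, hcu⟩ := commutatorsCentral_conjSigma hG n g (Pi.mulSingle 0 h)
  have hzero : leftMul (ℕ → G) (Pi.mulSingle 0 h) = conjSigma G (0 : ℕ) h := by
    simp [conjSigma_apply, sigma'_eq_leftMul]
  have heq : conjSigma G n g * conjSigma G (0 : ℕ) h =
      leftMul (ℕ → G) c * (conjSigma G (0 : ℕ) h * conjSigma G n g) := by
    rw [← hzero]
    ext1 v
    exact hcu v
  have hmem : leftMul (ℕ → G) c ∈ fixTail G (n + 1) := by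
    rw [← mul_inv_eq_iff_eq_mul] at heq
    have h₀ := fixTail_mono (Nat.le_add_left _ n) (conjSigma_mem_fixTail 0 h)
    have hn := conjSigma_mem_fixTail n g
    rw [← heq]
    exact mul_mem (mul_mem hn h₀) (inv_mem (mul_mem h₀ hn))
  refine ⟨_, conj_mem_centralConjSigma j (leftMul_mem_centralConjSigma (n + 1) hc fun k hk => ?_),
    ?_⟩
  · simpa using hmem 1 k hk
  · have := congrArg (MulAut.conj (xPerm G ^ j)) heq
    simp only [map_mul, MulAut.conj_apply, conj_conjSigma, Nat.cast_zero, add_zero] at this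
    exact this

end Words

/-- Let `G` be a finite group of nilpotency class at most two, and let `N` be the subgroup
of the permutation group of `G^ω` generated by `{xⁱ σ_g x⁻ⁱ : i ∈ ℤ, g ∈ G}`.  Every
non-identity `γ ∈ N` can be written uniquely as
`γ = x^{i₁} σ_{f₁} x^{-i₁} ⋯ x^{i_j} σ_{f_j} x^{-i_j}` with `j ≥ 1`, integers
`i₁ < … < i_j`, and `f₁, …, f_j ∈ G \ {1}`. -/
theorem normal_form {G : Type*} [Group G] [Finite G]
    (hG : ∀ g h : G, g⁻¹ * h⁻¹ * g * h ∈ Subgroup.center G)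
    (γ : Equiv.Perm (ℕ → G))
    (hγ : γ ∈ Subgroup.closure
      {p : Equiv.Perm (ℕ → G) | ∃ (i : ℤ) (g : G), p = xPerm G ^ i * sigma' g * (xPerm G ^ i)⁻¹})
    (hne : γ ≠ 1) :
    (∃ (j : ℕ) (_ : 0 < j) (i : Fin j → ℤ) (f : Fin j → G),
        StrictMono i ∧ (∀ l, f l ≠ 1) ∧
        γ = (List.ofFn (fun l : Fin j =>
          xPerm G ^ i l * sigma' (f l) * (xPerm G ^ i l)⁻¹)).prod) ∧
    (∀ (j j' : ℕ), 0 < j → 0 < j' →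
      ∀ (i : Fin j → ℤ) (i' : Fin j' → ℤ) (f : Fin j → G) (f' : Fin j' → G),
        StrictMono i → StrictMono i' → (∀ l, f l ≠ 1) → (∀ l, f' l ≠ 1) →
        γ = (List.ofFn (fun l : Fin j =>
          xPerm G ^ i l * sigma' (f l) * (xPerm G ^ i l)⁻¹)).prod →
        γ = (List.ofFn (fun l : Fin j' =>
          xPerm G ^ i' l * sigma' (f' l) * (xPerm G ^ i' l)⁻¹)).prod →
        ∃ hjj : j = j', ∀ l : Fin j,
          i l = i' (Fin.cast hjj l) ∧ f l = f' (Fin.cast hjj l)) := by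
  have hgen : {p : Equiv.Perm (ℕ → G) |
      ∃ (i : ℤ) (g : G), p = xPerm G ^ i * sigma' g * (xPerm G ^ i)⁻¹} =
      {p | ∃ i g, p = conjSigma G i g} := by
    simp only [conjSigma_apply]
  have hprod : ∀ (j : ℕ) (i : Fin j → ℤ) (f : Fin j → G),
      (List.ofFn fun l => xPerm G ^ i l * sigma' (f l) * (xPerm G ^ i l)⁻¹).prod =
        listProd (conjSigma G) (List.ofFn fun l => (i l, f l)) := by
    intro j i f
    simp only [listProd, List.map_ofFn, Function.comp_def, conjSigma_apply]
  simp only [hprod]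
  constructor
  · rw [hgen] at hγ
    obtain ⟨l₀, hl₀, rfl⟩ := exists_listProd_eq (conjSigma G)
      (fun i z hz j h => (commute_conjSigma_of_mem_centralTranslations
        (conjSigma_mem_centralTranslations i hz) j h).eq)
      (exists_conjSigma_mul_conjSigma_eq hG) hγ
    obtain ⟨l, hl, hl1, h⟩ := exists_increasingKeys_ne_one_listProd_eq (conjSigma G) hl₀
    rw [h] at hne ⊢
    refine ⟨l.length, List.length_pos_iff.2 fun h => hne (by rw [h, listProd_nil]),
      fun k => l[k].1, fun k => l[k].2, ?_, fun k => hl1 _ (List.getElem_mem _), ?_⟩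
    · intro a b hab
      exact List.pairwise_iff_getElem.1 hl a b a.2 b.2 hab
    · simp only [Prod.mk.eta, Fin.getElem_fin, List.ofFn_getElem]
  · intro j j' _ _ i i' f f' hi hi' hf hf' h h'
    have hinc : ∀ (j : ℕ) (i : Fin j → ℤ) (f : Fin j → G), StrictMono i →
        IncreasingKeys (List.ofFn fun l => (i l, f l)) := fun j i f hi =>
      List.pairwise_ofFn.2 fun _ _ hab => hi hab
    have heq := eq_of_listProd_eq (conjSigma G) (eventuallyFixTail G)
      (fun _ _ g h => conjSigma_mem_eventuallyFixTail h g)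
      (fun _ _ => eq_one_of_conjSigma_mem_eventuallyFixTail) _ _ (hinc j i f hi)
      (hinc j' i' f' hi') (by simpa [List.mem_ofFn] using hf) (by simpa [List.mem_ofFn] using hf')
      (h.symm.trans h')
    obtain rfl : j = j' := by simpa using congrArg List.length heq
    refine ⟨rfl, fun l => ?_⟩
    simpa using congrFun (List.ofFn_injective heq) l
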